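/- Let ψ be an entire function on ℂ such that the composition operator C_ψ : f ↦ f∘ψ is bounded on the Fock space 𝓕₂. Then C_ψ is not supercyclic on 𝓕₂. -/

import Mathlib

open MeasureTheory Finset

/-- Squared Fock-space norm: ‖f‖₂² = (1/π)∫_ℂ |f(z)|² e^{-|z|²} dA(z). -/
noncomputable def fockNormSq (f : ℂ → ℂ) : ℝ :=
  (1 / Real.pi) * ∫ z : ℂ, ‖f z‖ ^ 2 * Real.exp (-‖z‖ ^ 2)

/-- Membership in the Fock space 𝓕₂: entire and square Gaussian-integrable. -/
def MemFock (f : ℂ → ℂ) : Prop :=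
  Differentiable ℂ f ∧
  Integrable (fun z : ℂ => ‖f z‖ ^ 2 * Real.exp (-‖z‖ ^ 2))

/-- Fock-space inner product ⟨f,g⟩ = (1/π)∫_ℂ f(z)·conj(g(z))·e^{-|z|²} dA(z). -/
noncomputable def fockInner (f g : ℂ → ℂ) : ℂ :=
  (1 / (Real.pi : ℂ)) * ∫ z : ℂ, f z * (starRingEnd ℂ) (g z) * (Real.exp (-‖z‖ ^ 2) : ℂ)

/-- Reproducing kernel of the Fock space: K_w(z) = e^{z·conj(w)}. -/
noncomputable def fockKernel (w : ℂ) : ℂ → ℂ :=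
  fun z => Complex.exp (z * (starRingEnd ℂ) w)

/-- Weighted composition operator W_{(u,ψ)} f = u·(f∘ψ). -/
def wComp (u ψ : ℂ → ℂ) (f : ℂ → ℂ) : ℂ → ℂ := fun z => u z * f (ψ z)

/-- Composition operator C_ψ f = f∘ψ. -/
def compOp (ψ : ℂ → ℂ) (f : ℂ → ℂ) : ℂ → ℂ := fun z => f (ψ z)

/-- Multiplication operator M_u f = u·f. -/
def mulOp (u : ℂ → ℂ) (f : ℂ → ℂ) : ℂ → ℂ := fun z => u z * f z

/-- T maps 𝓕₂ into 𝓕₂ and is bounded there. -/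
def FockBoundedOp (T : (ℂ → ℂ) → ℂ → ℂ) : Prop :=
  (∀ f, MemFock f → MemFock (T f)) ∧
  ∃ C : ℝ, 0 ≤ C ∧ ∀ f, MemFock f → fockNormSq (T f) ≤ C * fockNormSq f

/-- f is a cyclic vector for T on 𝓕₂: the linear span of the orbit
{Tⁿ f : n ≥ 0} is dense in 𝓕₂. -/
def IsCyclicVec (T : (ℂ → ℂ) → ℂ → ℂ) (f : ℂ → ℂ) : Prop :=
  MemFock f ∧ ∀ g, MemFock g → ∀ ε : ℝ, 0 < ε →
    ∃ (n : ℕ) (c : Fin n → ℂ),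
      fockNormSq (fun z => (∑ i : Fin n, c i * T^[(i : ℕ)] f z) - g z) < ε

/-- T is cyclic on 𝓕₂. -/
def IsCyclicOp (T : (ℂ → ℂ) → ℂ → ℂ) : Prop := ∃ f, IsCyclicVec T f

/-- T is hypercyclic on 𝓕₂: some orbit {Tⁿ f : n ≥ 0} is dense. -/
def IsHypercyclicOp (T : (ℂ → ℂ) → ℂ → ℂ) : Prop :=
  ∃ f, MemFock f ∧ ∀ g, MemFock g → ∀ ε : ℝ, 0 < ε →
    ∃ n : ℕ, fockNormSq (fun z => T^[n] f z - g z) < ε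

/-- T is supercyclic on 𝓕₂: some projective orbit {λTⁿ f} is dense. -/
def IsSupercyclicOp (T : (ℂ → ℂ) → ℂ → ℂ) : Prop :=
  ∃ f, MemFock f ∧ ∀ g, MemFock g → ∀ ε : ℝ, 0 < ε →
    ∃ (lam : ℂ) (n : ℕ), fockNormSq (fun z => lam * T^[n] f z - g z) < ε

/-- T is invertible as a bounded operator on 𝓕₂. -/
def FockOpInvertible (T : (ℂ → ℂ) → ℂ → ℂ) : Prop :=
  (∀ f, MemFock f → MemFock (T f)) ∧
  ∃ S : (ℂ → ℂ) → ℂ → ℂ,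
    (∀ f, MemFock f → MemFock (S f)) ∧
    (∀ f, MemFock f → S (T f) = f) ∧
    (∀ f, MemFock f → T (S f) = f) ∧
    ∃ C : ℝ, 0 ≤ C ∧ ∀ f, MemFock f → fockNormSq (S f) ≤ C * fockNormSq f

/-- μ is an eigenvalue of the Hilbert-space adjoint W_{(u,ψ)}*, expressed via the
inner product: W* g = μ g for a nonzero g ∈ 𝓕₂, i.e. ⟨Wf, g⟩ = conj(μ)·⟨f, g⟩
for all f ∈ 𝓕₂. -/
def IsAdjointEigenvalue (u ψ : ℂ → ℂ) (μ : ℂ) : Prop :=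
  ∃ g, MemFock g ∧ g ≠ 0 ∧ ∀ f, MemFock f →
    fockInner (wComp u ψ f) g = (starRingEnd ℂ) μ * fockInner f g

lemma integrable_exp_neg_norm_sq : Integrable (fun z : ℂ => Real.exp (-‖z‖ ^ 2)) := by
  have h := GaussianFourier.integrable_cexp_neg_mul_sq_norm_add (V := ℂ) (b := 1)
    (by simp) 0 0
  refine h.norm.congr (Filter.Eventually.of_forall fun z => ?_)
  simp only [Complex.norm_exp]
  norm_cast
  simp

lemma integral_exp_neg_norm_sq_pos : 0 < ∫ z : ℂ, Real.exp (-‖z‖ ^ 2) :=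
  integral_exp_pos integrable_exp_neg_norm_sq

lemma fockNormSq_nonneg (f : ℂ → ℂ) : 0 ≤ fockNormSq f := by
  unfold fockNormSq
  positivity

lemma MemFock.comp_smul_sub {f g : ℂ → ℂ} (hf : MemFock f) (hg : MemFock g) (c : ℂ) :
    MemFock (fun z => c * f z - g z) := by
  have hd : Differentiable ℂ (fun z => c * f z - g z) := (hf.1.const_mul c).sub hg.1
  refine ⟨hd, Integrable.mono'
    ((hf.2.const_mul (2 * ‖c‖ ^ 2)).add (hg.2.const_mul 2)) ?_ ?_⟩
  · have := hd.continuous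
    exact Continuous.aestronglyMeasurable (by fun_prop)
  · refine Filter.Eventually.of_forall fun z => ?_
    have h1 : ‖c * f z - g z‖ ≤ ‖c‖ * ‖f z‖ + ‖g z‖ :=
      (norm_sub_le _ _).trans (by rw [norm_mul])
    have h2 : ‖c * f z - g z‖ ^ 2 ≤ 2 * ‖c‖ ^ 2 * ‖f z‖ ^ 2 + 2 * ‖g z‖ ^ 2 := by
      nlinarith [norm_nonneg (c * f z - g z), sq_nonneg (‖c‖ * ‖f z‖ - ‖g z‖)]
    rw [Real.norm_of_nonneg (by positivity)]
    calc _ ≤ (2 * ‖c‖ ^ 2 * ‖f z‖ ^ 2 + 2 * ‖g z‖ ^ 2) * Real.exp (-‖z‖ ^ 2) := by gcongr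
      _ = _ := by simp only [Pi.add_apply]; ring

lemma norm_fockKernel_sq_mul_exp (w z : ℂ) :
    ‖fockKernel w z‖ ^ 2 * Real.exp (-‖z‖ ^ 2)
      = Real.exp (‖w‖ ^ 2) * Real.exp (-‖z - w‖ ^ 2) := by
  simp only [fockKernel, Complex.norm_exp]
  rw [← Real.exp_nat_mul, ← Real.exp_add, ← Real.exp_add]
  congr 1
  simp only [← Complex.normSq_eq_norm_sq, Complex.normSq_apply]
  simp
  ring

lemma memFock_fockKernel (w : ℂ) : MemFock (fockKernel w) := by
  refine ⟨by unfold fockKernel; fun_prop, ?_⟩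
  simp only [norm_fockKernel_sq_mul_exp]
  exact (integrable_exp_neg_norm_sq.comp_sub_right w).const_mul _

lemma fockNormSq_fockKernel (w : ℂ) :
    fockNormSq (fockKernel w)
      = (1 / Real.pi * ∫ z : ℂ, Real.exp (-‖z‖ ^ 2)) * Real.exp (‖w‖ ^ 2) := by
  simp only [fockNormSq, norm_fockKernel_sq_mul_exp]
  rw [integral_const_mul, integral_sub_right_eq_self (fun z : ℂ => Real.exp (-‖z‖ ^ 2)) w]
  ring

/-- Mean value property of entire functions with respect to the Gaussian weight. -/
lemma integral_mul_exp_neg_norm_sq {F : ℂ → ℂ} (hF : Differentiable ℂ F)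
    (hi : Integrable (fun z : ℂ => F z * (Real.exp (-‖z‖ ^ 2) : ℂ))) :
    ∫ z : ℂ, F z * (Real.exp (-‖z‖ ^ 2) : ℂ) = F 0 * (∫ z : ℂ, Real.exp (-‖z‖ ^ 2) : ℝ) := by
  set G : ℂ → ℂ := fun z => F z * (Real.exp (-‖z‖ ^ 2) : ℂ) with hG
  have hGc : Continuous G := by
    have := hF.continuous
    fun_prop
  have hmp (θ : ℝ) := (rotation (Circle.exp θ)).measurePreserving
  have hme (θ : ℝ) : MeasurableEmbedding (rotation (Circle.exp θ)) :=
    (rotation (Circle.exp θ)).toHomeomorph.measurableEmbedding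
  have hrot (θ : ℝ) : ∫ z, G (rotation (Circle.exp θ) z) = ∫ z, G z :=
    (hmp θ).integral_comp (hme θ) G
  have hc : Continuous (fun p : ℝ × ℂ => G (rotation (Circle.exp p.1) p.2)) := by
    simp only [rotation_apply, Circle.coe_exp]
    fun_prop
  have hprod : Integrable (Function.uncurry fun (θ : ℝ) (z : ℂ) => G (rotation (Circle.exp θ) z))
      ((volume.restrict (Set.uIoc 0 (2 * Real.pi))).prod volume) := by
    refine (integrable_prod_iff hc.aestronglyMeasurable).mpr ?_
    refine ⟨Filter.Eventually.of_forall fun θ => (hmp θ).integrable_comp_of_integrable hi, ?_⟩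
    have : (fun θ : ℝ => ∫ z, ‖G (rotation (Circle.exp θ) z)‖) = fun _ => ∫ z, ‖G z‖ := by
      funext θ
      exact (hmp θ).integral_comp (hme θ) (fun z => ‖G z‖)
    simp only
    rw [this]
    exact intervalIntegrable_iff.mp intervalIntegrable_const
  have havg (z : ℂ) : ∫ θ in (0 : ℝ)..2 * Real.pi, G (rotation (Circle.exp θ) z)
      = 2 * Real.pi * (F 0 * (Real.exp (-‖z‖ ^ 2) : ℂ)) := by
    have hd : Differentiable ℂ (fun w => F (w * z)) := by fun_prop
    have h := (hd.diffContOnCl (s := Metric.ball 0 |(1 : ℝ)|)).circleAverage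
    rw [Real.circleAverage_def, zero_mul, Complex.real_smul] at h
    have h' : ∫ θ in (0 : ℝ)..2 * Real.pi, F (circleMap 0 1 θ * z) = 2 * Real.pi * F 0 := by
      rw [← h]
      push_cast
      rw [mul_inv_cancel_left₀ (by simp [Real.pi_ne_zero])]
    have : ∀ θ : ℝ, G (rotation (Circle.exp θ) z)
        = F (circleMap 0 1 θ * z) * (Real.exp (-‖z‖ ^ 2) : ℂ) := by
      intro θ
      simp [hG, rotation_apply, circleMap]
    simp only [this]
    rw [intervalIntegral.integral_mul_const, h']
    ring
  have hswap := intervalIntegral_integral_swap hprod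
  simp only [hrot, havg] at hswap
  rw [intervalIntegral.integral_const, integral_const_mul, integral_const_mul,
    integral_complex_ofReal, Complex.real_smul] at hswap
  have hpi : (2 * Real.pi : ℂ) ≠ 0 := by simp [Real.pi_ne_zero]
  apply mul_left_cancel₀ hpi
  rw [← hswap]
  push_cast
  ring

/-- Point evaluations are bounded on the Fock space, with the sharp exponential growth. -/
lemma norm_sq_le_fockNormSq {f : ℂ → ℂ} (hf : MemFock f) (z : ℂ) :
    (1 / Real.pi * ∫ u : ℂ, Real.exp (-‖u‖ ^ 2)) * ‖f z‖ ^ 2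
      ≤ Real.exp (‖z‖ ^ 2) * fockNormSq f := by
  set F : ℂ → ℂ := fun u => (f (u + z) * Complex.exp (-(u * (starRingEnd ℂ) z))) ^ 2 with hF
  have hfd := hf.1
  have hFd : Differentiable ℂ F := by fun_prop
  have hnorm (u : ℂ) : ‖F u * (Real.exp (-‖u‖ ^ 2) : ℂ)‖
      = Real.exp (‖z‖ ^ 2) * (‖f (u + z)‖ ^ 2 * Real.exp (-‖u + z‖ ^ 2)) := by
    simp only [hF, norm_mul, norm_pow, Complex.norm_exp, Complex.norm_real, Real.norm_eq_abs,
      Real.abs_exp]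
    have : Real.exp (-(u * (starRingEnd ℂ) z)).re ^ 2 * Real.exp (-‖u‖ ^ 2)
        = Real.exp (‖z‖ ^ 2) * Real.exp (-‖u + z‖ ^ 2) := by
      rw [← Real.exp_nat_mul, ← Real.exp_add, ← Real.exp_add]
      congr 1
      simp only [← Complex.normSq_eq_norm_sq, Complex.normSq_apply]
      simp
      ring
    linear_combination ‖f (u + z)‖ ^ 2 * this
  have hint : Integrable (fun u => F u * (Real.exp (-‖u‖ ^ 2) : ℂ)) := by
    have hFc := hFd.continuous
    rw [← integrable_norm_iff (Continuous.aestronglyMeasurable (by fun_prop))]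
    simp only [hnorm]
    exact (hf.2.comp_add_right z).const_mul _
  have hmv := integral_mul_exp_neg_norm_sq hFd hint
  have hle := norm_integral_le_integral_norm (μ := volume) (fun u => F u * (Real.exp (-‖u‖ ^ 2) : ℂ))
  rw [hmv] at hle
  simp only [hnorm] at hle
  rw [integral_const_mul,
    integral_add_right_eq_self (fun u : ℂ => ‖f u‖ ^ 2 * Real.exp (-‖u‖ ^ 2)) z, norm_mul,
    Complex.norm_real, Real.norm_of_nonneg integral_exp_neg_norm_sq_pos.le] at hle
  have hF0 : ‖F 0‖ = ‖f z‖ ^ 2 := by simp [hF]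
  rw [hF0] at hle
  unfold fockNormSq
  calc _ = 1 / Real.pi * (‖f z‖ ^ 2 * ∫ u : ℂ, Real.exp (-‖u‖ ^ 2)) := by ring
    _ ≤ 1 / Real.pi * (Real.exp (‖z‖ ^ 2) * ∫ u : ℂ, ‖f u‖ ^ 2 * Real.exp (-‖u‖ ^ 2)) := by
      gcongr
    _ = _ := by ring

lemma exists_norm_lt_of_fockNormSq_lt (z : ℂ) {ε : ℝ} (hε : 0 < ε) :
    ∃ δ > 0, ∀ f, MemFock f → fockNormSq f < δ → ‖f z‖ < ε := by
  set A := 1 / Real.pi * ∫ u : ℂ, Real.exp (-‖u‖ ^ 2) with hA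
  have hApos : 0 < A := mul_pos (by positivity) integral_exp_neg_norm_sq_pos
  have hE := Real.exp_pos (‖z‖ ^ 2)
  refine ⟨A * ε ^ 2 / Real.exp (‖z‖ ^ 2), by positivity, fun f hf hlt => ?_⟩
  rw [lt_div_iff₀ hE] at hlt
  have h := norm_sq_le_fockNormSq hf z
  have h2 : A * ‖f z‖ ^ 2 < A * ε ^ 2 := by linarith
  exact lt_of_pow_lt_pow_left₀ 2 hε.le (lt_of_mul_lt_mul_left h2 hApos.le)

lemma FockBoundedOp.exists_norm_sq_le {ψ : ℂ → ℂ} (h : FockBoundedOp (compOp ψ)) :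
    ∃ M : ℝ, 0 ≤ M ∧ ∀ z, ‖ψ z‖ ^ 2 ≤ ‖z‖ ^ 2 + M := by
  obtain ⟨hmem, C, hC, hb⟩ := h
  refine ⟨C, hC, fun z => ?_⟩
  set A := 1 / Real.pi * ∫ u : ℂ, Real.exp (-‖u‖ ^ 2) with hA
  have hApos : 0 < A := mul_pos (by positivity) integral_exp_neg_norm_sq_pos
  have hk := memFock_fockKernel (ψ z)
  have h1 := norm_sq_le_fockNormSq (hmem _ hk) z
  have h2 := hb _ hk
  rw [fockNormSq_fockKernel, ← hA] at h2
  have h3 : ‖compOp ψ (fockKernel (ψ z)) z‖ ^ 2 = Real.exp (‖ψ z‖ ^ 2) * Real.exp (‖ψ z‖ ^ 2) := by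
    have := norm_fockKernel_sq_mul_exp (ψ z) (ψ z)
    rw [sub_self, norm_zero, Real.exp_neg] at this
    field_simp at this
    simpa [compOp, sq] using this
  rw [h3, ← hA] at h1
  have h4 : A * Real.exp (‖ψ z‖ ^ 2) * Real.exp (‖ψ z‖ ^ 2)
      ≤ A * Real.exp (‖ψ z‖ ^ 2) * (Real.exp (‖z‖ ^ 2) * C) := by
    have := mul_le_mul_of_nonneg_left h2 (Real.exp_pos (‖z‖ ^ 2)).le
    linarith
  have h5 := le_of_mul_le_mul_left h4 (by positivity)
  have h6 : Real.exp (‖ψ z‖ ^ 2) ≤ Real.exp (‖z‖ ^ 2 + C) := by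
    rw [Real.exp_add]
    exact h5.trans (by gcongr; linarith [Real.add_one_le_exp C])
  exact Real.exp_le_exp.mp h6

lemma exists_affine_of_norm_le {ψ : ℂ → ℂ} (hψ : Differentiable ℂ ψ) {M : ℝ} (hM : 0 ≤ M)
    (h : ∀ z, ‖ψ z‖ ≤ ‖z‖ + M) : ∃ a b : ℂ, ∀ z, ψ z = a * z + b := by
  have hbd (z : ℂ) : ‖deriv ψ z‖ ≤ 2 + M := by
    have hR : 0 < ‖z‖ + 1 := by positivity
    have := Complex.norm_deriv_le_of_forall_mem_sphere_norm_le (C := (2 + M) * (‖z‖ + 1)) hR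
      (hψ.diffContOnCl (s := Metric.ball z (‖z‖ + 1))) (fun w hw => by
        have h1 : ‖w‖ ≤ ‖z‖ + (‖z‖ + 1) := norm_le_of_mem_closedBall (Metric.sphere_subset_closedBall hw)
        nlinarith [h w, norm_nonneg z])
    rwa [mul_div_cancel_right₀ _ hR.ne'] at this
  have hdd : Differentiable ℂ (deriv ψ) := fun z =>
    (hψ.analyticAt z).deriv.differentiableAt
  have hconst (z : ℂ) : deriv ψ z = deriv ψ 0 :=
    hdd.apply_eq_apply_of_bounded
      (isBounded_iff_forall_norm_le.mpr ⟨2 + M, by rintro _ ⟨z, rfl⟩; exact hbd z⟩) z 0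
  refine ⟨deriv ψ 0, ψ 0, fun z => ?_⟩
  have hg : Differentiable ℂ (fun z => ψ z - deriv ψ 0 * z) := by fun_prop
  have := is_const_of_deriv_eq_zero hg (fun w => by
    have h1 := ((hψ w).hasDerivAt.sub ((hasDerivAt_id w).const_mul (deriv ψ 0))).deriv
    have h2 : deriv (fun z => ψ z - deriv ψ 0 * z) w = deriv ψ w - deriv ψ 0 * 1 := h1
    rw [h2, hconst w]; ring) z 0
  simp only [mul_zero, sub_zero] at this
  linear_combination this

/-- The symbol of a bounded composition operator on the Fock space is a contractive affine map
with a fixed point. -/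
lemma FockBoundedOp.exists_fixed_affine {ψ : ℂ → ℂ} (hψ : Differentiable ℂ ψ)
    (h : FockBoundedOp (compOp ψ)) :
    ∃ a p : ℂ, ‖a‖ ≤ 1 ∧ ∀ u, ψ (p + u) = p + a * u := by
  obtain ⟨M, hM, hle⟩ := h.exists_norm_sq_le
  have hle' (z : ℂ) : ‖ψ z‖ ≤ ‖z‖ + (M + 1) := by
    refine (sq_le_sq₀ (norm_nonneg _) (by positivity)).mp ?_
    nlinarith [hle z, norm_nonneg z]
  obtain ⟨a, b, hab⟩ := exists_affine_of_norm_le hψ (by positivity) hle'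
  by_cases ha : a = 1
  · have hb : b = 0 := by
      by_contra hb
      have hbp : 0 < ‖b‖ ^ 2 := by positivity
      have ht := hle ((M / ‖b‖ ^ 2 : ℝ) * b)
      have h1 : ψ ((M / ‖b‖ ^ 2 : ℝ) * b) = ((M / ‖b‖ ^ 2 + 1 : ℝ) : ℂ) * b := by
        rw [hab, ha]; push_cast; ring
      rw [h1, norm_mul, norm_mul, Complex.norm_real, Complex.norm_real,
        Real.norm_of_nonneg (by positivity), Real.norm_of_nonneg (by positivity), mul_pow,
        mul_pow] at ht
      have h2 : M / ‖b‖ ^ 2 * ‖b‖ ^ 2 = M := by field_simp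
      nlinarith
    exact ⟨1, 0, by simp, fun u => by simp [hab, ha, hb]⟩
  · have ha' : 1 - a ≠ 0 := sub_ne_zero.mpr (Ne.symm ha)
    refine ⟨a, b / (1 - a), ?_, fun u => by rw [hab]; field_simp; ring⟩
    by_contra! hlt
    have hpos : 0 < ‖a‖ - 1 := by linarith
    set t : ℝ := (‖b‖ + (M + 1) + 1) / (‖a‖ - 1) with ht
    have htn : 0 ≤ t := by positivity
    have h1 := hle' t
    rw [hab, Complex.norm_real, Real.norm_of_nonneg htn] at h1
    have h2 : ‖a‖ * t ≤ ‖a * t + b‖ + ‖b‖ := by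
      have := norm_sub_le (a * t + b) b
      rwa [add_sub_cancel_right, norm_mul, Complex.norm_real, Real.norm_of_nonneg htn] at this
    have h3 : t * (‖a‖ - 1) = ‖b‖ + (M + 1) + 1 := by rw [ht]; field_simp
    linarith

lemma compOp_iterate (ψ f : ℂ → ℂ) (n : ℕ) (z : ℂ) :
    (compOp ψ)^[n] f z = f (ψ^[n] z) := by
  induction n generalizing z with
  | zero => rfl
  | succ n ih => rw [Function.iterate_succ_apply', Function.iterate_succ_apply, compOp, ih]

lemma FockBoundedOp.memFock_iterate {T : (ℂ → ℂ) → ℂ → ℂ} (h : FockBoundedOp T) {f : ℂ → ℂ}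
    (hf : MemFock f) (n : ℕ) : MemFock (T^[n] f) := by
  induction n with
  | zero => exact hf
  | succ n ih => rw [Function.iterate_succ_apply']; exact h.1 _ ih

/-- no bounded composition operator on 𝓕₂ is supercyclic. -/
theorem composition_not_supercyclic (ψ : ℂ → ℂ) (hψ : Differentiable ℂ ψ)
    (hbdd : FockBoundedOp (compOp ψ)) :
    ¬ IsSupercyclicOp (compOp ψ) := by
  rintro ⟨f, hf, hdense⟩
  obtain ⟨a, p, ha, hap⟩ := hbdd.exists_fixed_affine hψ
  have hit (n : ℕ) (u : ℂ) : ψ^[n] (p + u) = p + a ^ n * u := by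
    induction n with
    | zero => simp
    | succ n ih => rw [Function.iterate_succ_apply', ih, hap]; ring
  have hfix (n : ℕ) : ψ^[n] p = p := by simpa using hit n 0
  have happrox (g : ℂ → ℂ) (hg : MemFock g) (z w : ℂ) (ε : ℝ) (hε : 0 < ε) :
      ∃ (c : ℂ) (n : ℕ), ‖c * f (ψ^[n] z) - g z‖ < ε ∧ ‖c * f (ψ^[n] w) - g w‖ < ε := by
    obtain ⟨δ₁, hδ₁, h₁⟩ := exists_norm_lt_of_fockNormSq_lt z hε
    obtain ⟨δ₂, hδ₂, h₂⟩ := exists_norm_lt_of_fockNormSq_lt w hε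
    obtain ⟨c, n, hcn⟩ := hdense g hg (min δ₁ δ₂) (lt_min hδ₁ hδ₂)
    have hm := (hbdd.memFock_iterate hf n).comp_smul_sub hg c
    have e₁ := h₁ _ hm (hcn.trans_le (min_le_left _ _))
    have e₂ := h₂ _ hm (hcn.trans_le (min_le_right _ _))
    simp only [compOp_iterate] at e₁ e₂
    exact ⟨c, n, e₁, e₂⟩
  have hfp : f p ≠ 0 := by
    intro h0
    obtain ⟨c, n, h, -⟩ := happrox _ (memFock_fockKernel 0) p p 1 one_pos
    simp [hfix, h0, fockKernel] at h
  obtain ⟨B, hB⟩ := (isCompact_closedBall p 1).exists_bound_of_continuousOn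
    hf.1.continuous.continuousOn
  have hB0 : 0 ≤ B := (norm_nonneg _).trans (hB p (by simp))
  have hfB (n : ℕ) : ‖f (ψ^[n] (p + 1))‖ ≤ B := by
    refine hB _ ?_
    rw [hit, mem_closedBall_iff_norm, mul_one, add_sub_cancel_left, norm_pow]
    exact pow_le_one₀ (norm_nonneg _) ha
  set g : ℂ → ℂ := fun z => Complex.exp p * fockKernel 0 z - fockKernel 1 z with hg
  have hgm : MemFock g := (memFock_fockKernel 0).comp_smul_sub (memFock_fockKernel 1) _
  have hgp : g p = 0 := by simp [hg, fockKernel]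
  have hgq : g (p + 1) ≠ 0 := by
    have h1 : g (p + 1) = Complex.exp p * (1 - Complex.exp 1) := by
      simp [hg, fockKernel, Complex.exp_add]; ring
    rw [h1]
    refine mul_ne_zero (Complex.exp_ne_zero _) (sub_ne_zero.mpr fun h => ?_)
    have h2 : Real.exp 1 = 1 := by
      rw [← Complex.ofReal_inj, Complex.ofReal_exp]
      simpa only [Complex.ofReal_one] using h.symm
    simp at h2
  have hfp' : 0 < ‖f p‖ := norm_pos_iff.mpr hfp
  have hgq' : 0 < ‖g (p + 1)‖ := norm_pos_iff.mpr hgq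
  obtain ⟨c, n, h₁, h₂⟩ := happrox g hgm p (p + 1)
    (‖g (p + 1)‖ * ‖f p‖ / (‖f p‖ + B)) (by positivity)
  set ε := ‖g (p + 1)‖ * ‖f p‖ / (‖f p‖ + B) with hε
  have hεeq : ε * (‖f p‖ + B) = ‖g (p + 1)‖ * ‖f p‖ := by rw [hε]; field_simp
  rw [hfix, hgp, sub_zero, norm_mul] at h₁
  have h₃ : ‖g (p + 1)‖ < ε + ‖c‖ * B := by
    have := norm_sub_norm_le (g (p + 1)) (c * f (ψ^[n] (p + 1)))
    rw [norm_sub_rev (g (p + 1)), norm_mul] at this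
    have := mul_le_mul_of_nonneg_left (hfB n) (norm_nonneg c)
    linarith
  have h₄ := mul_lt_mul_of_pos_right h₃ hfp'
  have h₅ := mul_le_mul_of_nonneg_right h₁.le hB0
  nlinarith
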